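/- Every triple at a vertex of the graph of regular Markov numbers is a Markov triple: if the triple of sequences (α,γ,β) is reachable from the root ((1,1),(1,1,2,2),(2,2)) by a finite sequence of the moves L and R, then the integer sines x = K̆(α), z = K̆(γ), y = K̆(β) satisfy x² + y² + z² = 3xyz. -/

import Mathlib

/-- The continuant `K(a₁,…,aₖ)` of a finite sequence of integers. -/
def continuant : List ℤ → ℤ
  | [] => 1
  | [a] => a
  | a :: b :: t => a * continuant (b :: t) + continuant t

/-- The integer sine `K̆(α)`: the continuant of `α` with its last entry removed. -/
def intSine (l : List ℤ) : ℤ := continuant l.dropLast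

abbrev Triple := List ℤ × List ℤ × List ℤ

/-- The move `L(α,γ,β) = (α, α⊕γ, γ)`. -/
def Lmove (v : Triple) : Triple := (v.1, v.1 ++ v.2.1, v.2.1)

/-- The move `R(α,γ,β) = (γ, γ⊕β, β)`. -/
def Rmove (v : Triple) : Triple := (v.2.1, v.2.1 ++ v.2.2, v.2.2)

/-- One edge step in the binary graph. -/
def GStep (v w : Triple) : Prop := w = Lmove v ∨ w = Rmove v

/-- Reachability by a finite sequence of moves `L` and `R`. -/
def Reach : Triple → Triple → Prop := Relation.ReflTransGen GStep

/-- `χ(α,γ,β) = (K̆ α, K̆ γ, K̆ β)`. -/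
def chi (v : Triple) : ℤ × ℤ × ℤ := (intSine v.1, intSine v.2.1, intSine v.2.2)

/-- The root `((1,1), (1,1,2,2), (2,2))` of the regular Markov graph. -/
def markovRoot : Triple := ([1, 1], [1, 1] ++ [2, 2], [2, 2])

/-- The product of the elementary matrices `!![a, 1; 1, 0]` over the entries `a` of a sequence. -/
def continuantMatrix (l : List ℤ) : Matrix (Fin 2) (Fin 2) ℤ :=
  (l.map fun a => !![a, 1; 1, 0]).prod

theorem continuantMatrix_append (l m : List ℤ) :
    continuantMatrix (l ++ m) = continuantMatrix l * continuantMatrix m := by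
  simp [continuantMatrix]

theorem continuantMatrix_cons (a : ℤ) (l : List ℤ) :
    continuantMatrix (a :: l) = !![a, 1; 1, 0] * continuantMatrix l := by
  simp [continuantMatrix]

theorem continuantMatrix_zero_zero (l : List ℤ) : continuantMatrix l 0 0 = continuant l := by
  induction l using continuant.induct with
  | case1 => simp [continuantMatrix, continuant]
  | case2 a => simp [continuantMatrix, continuant]
  | case3 a b t ih₁ ih₂ =>
    have h : continuantMatrix (b :: t) 1 0 = continuantMatrix t 0 0 := by
      simp [continuantMatrix_cons, Matrix.mul_apply, Fin.sum_univ_two]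
    rw [continuantMatrix_cons, Matrix.mul_apply, Fin.sum_univ_two, h, ih₁, ih₂]
    simp [continuant]

theorem intSine_eq_continuantMatrix {l : List ℤ} (hl : l ≠ []) :
    intSine l = continuantMatrix l 0 1 := by
  obtain ⟨m, a, rfl⟩ := List.eq_nil_or_concat l |>.resolve_left hl
  simp [intSine, ← continuantMatrix_zero_zero, continuantMatrix, Matrix.mul_apply,
    Fin.sum_univ_two]

/-- A unimodular matrix whose trace is three times its upper right entry. -/
structure IsCohnMatrix (A : Matrix (Fin 2) (Fin 2) ℤ) : Prop where
  det_eq : A.det = 1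
  trace_eq : A.trace = 3 * A 0 1

/-- Two Cohn matrices whose product is one too, the upper right entries forming a Markov triple. -/
structure IsCohnPair (A B : Matrix (Fin 2) (Fin 2) ℤ) : Prop where
  left : IsCohnMatrix A
  right : IsCohnMatrix B
  mul : IsCohnMatrix (A * B)
  markov : (A 0 1) ^ 2 + (B 0 1) ^ 2 + ((A * B) 0 1) ^ 2 = 3 * A 0 1 * B 0 1 * (A * B) 0 1

theorem mul_self_eq_trace_smul_sub_one {A : Matrix (Fin 2) (Fin 2) ℤ} (hA : A.det = 1) :
    A * A = A.trace • A - 1 := by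
  rw [Matrix.det_fin_two] at hA
  ext i j
  fin_cases i <;> fin_cases j <;>
    simp [Matrix.mul_apply, Fin.sum_univ_two, Matrix.trace_fin_two, -zsmul_eq_mul] <;> linarith

theorem IsCohnPair.mul_right {A B : Matrix (Fin 2) (Fin 2) ℤ} (h : IsCohnPair A B) :
    IsCohnPair A (A * B) := by
  have e : A * (A * B) = A.trace • (A * B) - B := by
    rw [← mul_assoc, mul_self_eq_trace_smul_sub_one h.left.det_eq, sub_mul, one_mul,
      Matrix.smul_mul]
  have e01 : (A * (A * B)) 0 1 = 3 * A 0 1 * (A * B) 0 1 - B 0 1 := by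
    rw [e, h.left.trace_eq, Matrix.sub_apply, Matrix.smul_apply, smul_eq_mul]
  refine ⟨h.left, h.mul, ⟨?_, ?_⟩, ?_⟩
  · rw [Matrix.det_mul, h.left.det_eq, h.mul.det_eq, one_mul]
  · rw [e01, e, Matrix.trace_sub, Matrix.trace_smul, h.left.trace_eq, h.mul.trace_eq,
      h.right.trace_eq, smul_eq_mul]
    ring
  · rw [e01]
    linear_combination h.markov

theorem IsCohnPair.mul_left {A B : Matrix (Fin 2) (Fin 2) ℤ} (h : IsCohnPair A B) :
    IsCohnPair (A * B) B := by
  have e : A * B * B = B.trace • (A * B) - A := by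
    rw [mul_assoc, mul_self_eq_trace_smul_sub_one h.right.det_eq, mul_sub, mul_one,
      Matrix.mul_smul]
  have e01 : (A * B * B) 0 1 = 3 * B 0 1 * (A * B) 0 1 - A 0 1 := by
    rw [e, h.right.trace_eq, Matrix.sub_apply, Matrix.smul_apply, smul_eq_mul]
  refine ⟨h.mul, h.right, ⟨?_, ?_⟩, ?_⟩
  · rw [Matrix.det_mul, h.right.det_eq, h.mul.det_eq, one_mul]
  · rw [e01, e, Matrix.trace_sub, Matrix.trace_smul, h.right.trace_eq, h.mul.trace_eq,
      h.left.trace_eq, smul_eq_mul]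
    ring
  · rw [e01]
    linear_combination h.markov

theorem isCohnPair_root : IsCohnPair (continuantMatrix [1, 1]) (continuantMatrix [2, 2]) := by
  refine ⟨⟨?_, ?_⟩, ⟨?_, ?_⟩, ⟨?_, ?_⟩, ?_⟩ <;>
    simp [continuantMatrix, Matrix.det_fin_two, Matrix.trace_fin_two]

theorem Reach.isCohnPair {v : Triple} (hv : Reach markovRoot v) :
    v.1 ≠ [] ∧ v.2.2 ≠ [] ∧ v.2.1 = v.1 ++ v.2.2 ∧
      IsCohnPair (continuantMatrix v.1) (continuantMatrix v.2.2) := by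
  unfold Reach at hv
  induction hv with
  | refl => exact ⟨by simp [markovRoot], by simp [markovRoot], rfl, isCohnPair_root⟩
  | tail _ hstep ih =>
    obtain ⟨hα, hβ, hγ, h⟩ := ih
    rcases hstep with rfl | rfl
    · refine ⟨hα, by simp [Lmove, hγ, hα], rfl, ?_⟩
      simpa only [Lmove, hγ, continuantMatrix_append] using h.mul_right
    · refine ⟨by simp [Rmove, hγ, hα], hβ, rfl, ?_⟩
      simpa only [Rmove, hγ, continuantMatrix_append] using h.mul_left

/-- Every triple at a vertex of the graph of regular Markov numbers is a Markov triple. -/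
theorem markov_vertex_is_markov_triple (v : Triple) (hv : Reach markovRoot v) :
    (intSine v.1) ^ 2 + (intSine v.2.2) ^ 2 + (intSine v.2.1) ^ 2
      = 3 * intSine v.1 * intSine v.2.2 * intSine v.2.1 := by
  obtain ⟨hα, hβ, hγ, h⟩ := Reach.isCohnPair hv
  rw [hγ, intSine_eq_continuantMatrix hα, intSine_eq_continuantMatrix hβ,
    intSine_eq_continuantMatrix (List.append_ne_nil_of_left_ne_nil hα _),
    continuantMatrix_append]
  exact h.markov
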